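/- arXiv:2501.01325 — 2 statements merged into one kernel-verified Lean document; each statement's English description precedes it below -/
import Mathlib

section
/- Let X = (X₁,…,X_d) be a d-tuple of n×n complex matrices and let ρ(X) = lim_{m→∞} ‖Σ_{|w|=m} X^w (X^w)^*‖^{1/(2m)} be its joint (row) spectral radius. Then ρ(X) = inf{ ‖Σ_{j=1}^d (S⁻¹X_jS)(S⁻¹X_jS)^*‖^{1/2} : S ∈ GLₙ(ℂ) }. In particular, ρ(X) < 1 if and only if there exists S ∈ GLₙ(ℂ) with ‖Σ_j (S⁻¹X_jS)(S⁻¹X_jS)^*‖ < 1. -/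
open Filter Topology
open scoped Matrix

/-- The operator norm of a square complex matrix, viewed as a linear operator on
Euclidean space (largest singular value). -/
noncomputable def opNorm {ι : Type*} [Fintype ι] [DecidableEq ι] (X : Matrix ι ι ℂ) : ℝ :=
  ‖Matrix.toEuclideanCLM (𝕜 := ℂ) X‖

/-- For a word `w = w₁⋯wₙ`, the ordered product `T_{w₁} T_{w₂} ⋯ T_{wₙ}`. -/
def wordProd {M : Type*} [Monoid M] {d n : ℕ} (T : Fin d → M) (w : Fin n → Fin d) : M :=
  (List.ofFn fun i => T (w i)).prod

/-- The joint (row) spectral radius `ρ(X) = lim_m ‖Σ_{|w|=m} X^w (X^w)^*‖^{1/2m}` of a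
`d`-tuple of matrices, expressed as the infimum over `m ≥ 1` (the limit exists by
submultiplicativity and equals this infimum). -/
noncomputable def rowSpecRad {ι : Type*} [Fintype ι] [DecidableEq ι] {d : ℕ}
    (X : Fin d → Matrix ι ι ℂ) : ℝ :=
  ⨅ m : {m : ℕ // 1 ≤ m},
    opNorm (∑ w : Fin (m : ℕ) → Fin d, wordProd X w * (wordProd X w)ᴴ)
      ^ ((1 : ℝ) / (2 * (m : ℕ)))

section CStarAlgebra

/-- The sum `Σ_{|w|=m} X^w (X^w)^*`. -/
def wordSum {A : Type*} [Semiring A] [StarRing A] {d : ℕ} (X : Fin d → A) (m : ℕ) : A :=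
  ∑ w : Fin m → Fin d, wordProd X w * star (wordProd X w)

/-- The sum `Σ_j (S⁻¹X_jS)(S⁻¹X_jS)^*`. -/
def similarityGram {A : Type*} [Semiring A] [StarRing A] {d : ℕ} (X : Fin d → A) (S : Aˣ) : A :=
  ∑ j, (↑S⁻¹ * X j * S) * star (↑S⁻¹ * X j * S)

lemma wordSum_zero {A : Type*} [Semiring A] [StarRing A] {d : ℕ} (X : Fin d → A) :
    wordSum X 0 = 1 := by
  simp [wordSum, wordProd]

lemma wordSum_succ {A : Type*} [Semiring A] [StarRing A] {d : ℕ} (X : Fin d → A) (m : ℕ) :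
    wordSum X (m + 1) = ∑ j, X j * wordSum X m * star (X j) := by
  rw [wordSum, ← (Fin.consEquiv fun _ => Fin d).sum_comp, Fintype.sum_prod_type]
  simp [wordSum, wordProd, Fin.consEquiv, List.ofFn_succ, Finset.mul_sum, Finset.sum_mul,
    mul_assoc]

variable {A : Type*} [CStarAlgebra A] [PartialOrder A] [StarOrderedRing A] {d : ℕ}

lemma wordSum_nonneg (X : Fin d → A) (m : ℕ) : 0 ≤ wordSum X m :=
  Finset.sum_nonneg fun _ _ => mul_star_self_nonneg _

lemma similarityGram_nonneg (X : Fin d → A) (S : Aˣ) : 0 ≤ similarityGram X S :=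
  Finset.sum_nonneg fun _ _ => mul_star_self_nonneg _

/-- The row operator of `S⁻¹XS` has squared norm at most `c` iff the completely positive map
`P ↦ Σ_j X_j P X_j^*` sends `SS^*` below `c • SS^*`. -/
lemma norm_sum_similarity_le_iff (X : Fin d → A) (S : Aˣ) {c : ℝ} (hc : 0 ≤ c) :
    ‖similarityGram X S‖ ≤ c ↔
      ∑ j, X j * (S * star (S : A)) * star (X j) ≤ c • ((S : A) * star (S : A)) := by
  rw [CStarAlgebra.norm_le_iff_le_algebraMap _ hc
    (similarityGram_nonneg X S)]
  have hinv : (star (S : A)) * star (↑S⁻¹ : A) = 1 := by rw [← star_mul]; simp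
  have hinv' : star (↑S⁻¹ : A) * (star (S : A)) = 1 := by rw [← star_mul]; simp
  have key : similarityGram X S =
      ↑S⁻¹ * (∑ j, X j * (S * star (S : A)) * star (X j)) * star (↑S⁻¹ : A) := by
    simp [similarityGram, Finset.mul_sum, Finset.sum_mul, mul_assoc]
  rw [key]
  constructor <;> intro h
  · have := star_right_conjugate_le_conjugate h (S : A)
    simpa [Algebra.algebraMap_eq_smul_one, mul_assoc, hinv'] using this
  · have := star_right_conjugate_le_conjugate h (↑S⁻¹ : A)
    simpa [Algebra.algebraMap_eq_smul_one, mul_assoc, hinv] using this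

lemma exists_norm_wordSum_le (X : Fin d → A) (S : Aˣ) {c : ℝ}
    (hc : 0 ≤ c) (h : ‖similarityGram X S‖ ≤ c) :
    ∃ K : ℝ, 0 < K ∧ ∀ m, ‖wordSum X m‖ ≤ K * c ^ m := by
  rw [norm_sum_similarity_le_iff X S hc] at h
  set P : A := S * star (S : A) with hP
  have hP0 : 0 ≤ P := mul_star_self_nonneg _
  set k : ℝ := ‖(↑S⁻¹ : A) * star (↑S⁻¹ : A)‖
  have hk : 0 ≤ k := norm_nonneg _
  have h1 : 1 ≤ k • P := by
    have := star_right_conjugate_le_conjugate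
      (IsSelfAdjoint.le_algebraMap_norm_self
        (.of_nonneg (mul_star_self_nonneg (↑S⁻¹ : A)))) (S : A)
    have hinv' : star (↑S⁻¹ : A) * (star (S : A)) = 1 := by rw [← star_mul]; simp
    simpa [Algebra.algebraMap_eq_smul_one, mul_assoc, hinv'] using this
  have hw : ∀ m, wordSum X m ≤ (k * c ^ m) • P := by
    intro m
    induction m with
    | zero => simpa [wordSum_zero] using h1
    | succ m ih =>
      calc wordSum X (m + 1) = ∑ j, X j * wordSum X m * star (X j) := wordSum_succ X m
        _ ≤ ∑ j, X j * ((k * c ^ m) • P) * star (X j) :=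
          Finset.sum_le_sum fun j _ => star_right_conjugate_le_conjugate ih _
        _ = (k * c ^ m) • ∑ j, X j * P * star (X j) := by
          simp [Finset.smul_sum]
        _ ≤ (k * c ^ m) • (c • P) := smul_le_smul_of_nonneg_left h (by positivity)
        _ = (k * c ^ (m + 1)) • P := by rw [smul_smul, pow_succ, mul_assoc]
  refine ⟨k * ‖P‖ + 1, by positivity, fun m => ?_⟩
  calc ‖wordSum X m‖ ≤ ‖(k * c ^ m) • P‖ :=
        CStarAlgebra.norm_le_norm_of_nonneg_of_le (wordSum_nonneg X m) (hw m)
    _ = k * ‖P‖ * c ^ m := by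
        rw [norm_smul, Real.norm_of_nonneg (by positivity)]; ring
    _ ≤ (k * ‖P‖ + 1) * c ^ m := by gcongr; linarith

/-- The similarity is the square root of `P = Σ_{k<m} c⁻ᵏ Σ_{|w|=k} X^w (X^w)^*`. -/
lemma exists_similarity_norm_le (X : Fin d → A) {c : ℝ} (hc : 0 < c) {m : ℕ} (hm : 1 ≤ m)
    (h : ‖wordSum X m‖ ≤ c ^ m) :
    ∃ S : Aˣ, ‖similarityGram X S‖ ≤ c := by
  set f : ℕ → A := fun k => (c⁻¹) ^ k • wordSum X k with hf
  set P : A := ∑ k ∈ Finset.range m, f k with hP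
  have hf0 : ∀ k, 0 ≤ f k := fun k => smul_nonneg (by positivity) (wordSum_nonneg X k)
  have hf_zero : f 0 = 1 := by simp [hf, wordSum_zero]
  have hfm : f m ≤ 1 := by
    have hle := (CStarAlgebra.norm_le_iff_le_algebraMap _ (by positivity)
      (wordSum_nonneg X m)).1 h
    calc f m ≤ (c⁻¹) ^ m • algebraMap ℝ A (c ^ m) :=
          smul_le_smul_of_nonneg_left hle (by positivity)
      _ = 1 := by
          rw [Algebra.algebraMap_eq_smul_one, smul_smul, ← mul_pow, inv_mul_cancel₀ hc.ne']
          simp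
  have hP1 : 1 ≤ P := by
    rw [← hf_zero]
    exact Finset.single_le_sum (fun k _ => hf0 k) (Finset.mem_range.2 hm)
  have hP0 : 0 ≤ P := Finset.sum_nonneg fun k _ => hf0 k
  have hmap : ∑ j, X j * P * star (X j) = c • ∑ k ∈ Finset.range m, f (k + 1) := by
    simp only [hP, Finset.mul_sum, Finset.sum_mul, Finset.smul_sum]
    rw [Finset.sum_comm]
    refine Finset.sum_congr rfl fun k _ => ?_
    simp only [hf, wordSum_succ, smul_smul, pow_succ, mul_smul_comm, smul_mul_assoc,
      ← Finset.smul_sum]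
    congr 1
    field_simp
  have hle : ∑ j, X j * P * star (X j) ≤ c • P := by
    rw [hmap]
    refine smul_le_smul_of_nonneg_left ?_ hc.le
    have h1 := Finset.sum_range_succ f m
    rw [Finset.sum_range_succ'] at h1
    rw [hf_zero] at h1
    rw [eq_sub_of_add_eq h1, sub_le_iff_le_add]
    exact add_le_add_right hfm _
  have hu : IsUnit (CFC.sqrt P) :=
    (CFC.isUnit_sqrt_iff P hP0).2 (CStarAlgebra.isUnit_of_le 1 hP1)
  obtain ⟨S, hS⟩ := hu
  have hSS : (S : A) * star (S : A) = P := by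
    rw [hS, (CFC.sqrt_nonneg P).star_eq, CFC.sqrt_mul_sqrt_self P hP0]
  exact ⟨S, by rwa [norm_sum_similarity_le_iff X S hc.le, hSS]⟩

end CStarAlgebra

section RowSpecRad

open scoped Matrix.Norms.L2Operator MatrixOrder

variable {n d : ℕ} (X : Fin d → Matrix (Fin n) (Fin n) ℂ)

lemma rowSpecRad_eq_iInf_wordSum : rowSpecRad X =
    ⨅ m : {m : ℕ // 1 ≤ m}, ‖wordSum X m‖ ^ ((1 : ℝ) / (2 * (m : ℕ))) := rfl

lemma rowSpecRad_le {m : ℕ} (hm : 1 ≤ m) :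
    rowSpecRad X ≤ ‖wordSum X m‖ ^ ((1 : ℝ) / (2 * m)) := by
  rw [rowSpecRad_eq_iInf_wordSum]
  exact ciInf_le ⟨0, by rintro _ ⟨_, rfl⟩; positivity⟩ (⟨m, hm⟩ : {m : ℕ // 1 ≤ m})

lemma rowSpecRad_nonneg : 0 ≤ rowSpecRad X := by
  rw [rowSpecRad_eq_iInf_wordSum]
  exact Real.iInf_nonneg fun _ => by positivity

lemma exists_similarity_of_rowSpecRad_lt {r : ℝ} (hr : rowSpecRad X < r) :
    ∃ S : (Matrix (Fin n) (Fin n) ℂ)ˣ,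
      ‖similarityGram X S‖ ≤ r ^ 2 := by
  have hr0 : 0 < r := (rowSpecRad_nonneg X).trans_lt hr
  have : Nonempty {m : ℕ // 1 ≤ m} := ⟨⟨1, le_rfl⟩⟩
  rw [rowSpecRad_eq_iInf_wordSum] at hr
  obtain ⟨⟨m, hm⟩, hlt⟩ := exists_lt_of_ciInf_lt hr
  refine exists_similarity_norm_le X (by positivity) hm ?_
  have hm' : (0 : ℝ) < 2 * m := by positivity
  rw [one_div] at hlt
  have := (Real.rpow_inv_le_iff_of_pos (norm_nonneg _) hr0.le hm').1 hlt.le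
  rw [← pow_mul]
  exact_mod_cast this

lemma eventually_rpow_wordSum_lt (S : (Matrix (Fin n) (Fin n) ℂ)ˣ) {s r : ℝ} (hs : 0 ≤ s)
    (hsr : s < r) (h : ‖similarityGram X S‖ ≤ s ^ 2) :
    ∀ᶠ m : ℕ in atTop, ‖wordSum X m‖ ^ ((1 : ℝ) / (2 * m)) < r := by
  obtain ⟨K, hK, hw⟩ := exists_norm_wordSum_le X S (sq_nonneg s) h
  have hexp : Tendsto (fun m : ℕ => (1 : ℝ) / (2 * m)) atTop (𝓝 0) :=
    tendsto_const_nhds.div_atTop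
      (tendsto_natCast_atTop_atTop.const_mul_atTop (by norm_num : (0 : ℝ) < 2))
  have hlim : Tendsto (fun m : ℕ => K ^ ((1 : ℝ) / (2 * m)) * s) atTop (𝓝 s) := by
    simpa using ((tendsto_const_nhds (x := K)).rpow hexp (Or.inl hK.ne')).mul_const s
  filter_upwards [hlim.eventually_lt_const hsr, eventually_ge_atTop 1] with m hm h1
  refine lt_of_le_of_lt ?_ hm
  calc ‖wordSum X m‖ ^ ((1 : ℝ) / (2 * m)) ≤ (K * (s ^ 2) ^ m) ^ ((1 : ℝ) / (2 * m)) := by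
        gcongr
        exact hw m
    _ = K ^ ((1 : ℝ) / (2 * m)) * s := by
        rw [Real.mul_rpow hK.le (by positivity), ← pow_mul, one_div]
        congr 1
        have := Real.pow_rpow_inv_natCast hs (n := 2 * m) (by omega)
        simpa using this

lemma rowSpecRad_le_sqrt_norm (S : (Matrix (Fin n) (Fin n) ℂ)ˣ) :
    rowSpecRad X ≤ √‖similarityGram X S‖ := by
  refine le_of_forall_gt fun r hr => ?_
  obtain ⟨m, hm, h1⟩ := ((eventually_rpow_wordSum_lt X S (Real.sqrt_nonneg _) hr
    (Real.sq_sqrt (norm_nonneg _)).ge).and (eventually_ge_atTop 1)).exists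
  exact (rowSpecRad_le X h1).trans_lt hm

lemma tendsto_rpow_wordSum :
    Tendsto (fun m : ℕ => ‖wordSum X m‖ ^ ((1 : ℝ) / (2 * m))) atTop (𝓝 (rowSpecRad X)) := by
  refine tendsto_order.2 ⟨fun a ha => ?_, fun r hr => ?_⟩
  · filter_upwards [eventually_ge_atTop 1] with m hm using ha.trans_le (rowSpecRad_le X hm)
  · obtain ⟨s, hs, hsr⟩ := exists_between hr
    obtain ⟨S, hS⟩ := exists_similarity_of_rowSpecRad_lt X hs
    exact eventually_rpow_wordSum_lt X S ((rowSpecRad_nonneg X).trans hs.le) hsr hS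

lemma isGLB_rowSpecRad : IsGLB {r : ℝ | ∃ S : (Matrix (Fin n) (Fin n) ℂ)ˣ,
    r = √‖similarityGram X S‖} (rowSpecRad X) := by
  constructor
  · rintro _ ⟨S, rfl⟩
    exact rowSpecRad_le_sqrt_norm X S
  · refine fun b hb => le_of_forall_gt_imp_ge_of_dense fun r hr => ?_
    obtain ⟨S, hS⟩ := exists_similarity_of_rowSpecRad_lt X hr
    exact (hb ⟨S, rfl⟩).trans
      (Real.sqrt_le_iff.2 ⟨(rowSpecRad_nonneg X).trans hr.le, hS⟩)

lemma rowSpecRad_lt_one_iff : rowSpecRad X < 1 ↔ ∃ S : (Matrix (Fin n) (Fin n) ℂ)ˣ,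
    ‖similarityGram X S‖ < 1 := by
  constructor
  · intro h
    obtain ⟨r, hr, hr1⟩ := exists_between h
    obtain ⟨S, hS⟩ := exists_similarity_of_rowSpecRad_lt X hr
    have hr0 := (rowSpecRad_nonneg X).trans hr.le
    exact ⟨S, hS.trans_lt (pow_lt_one₀ hr0 hr1 two_ne_zero)⟩
  · rintro ⟨S, hS⟩
    exact (rowSpecRad_le_sqrt_norm X S).trans_lt
      ((Real.sqrt_lt' one_pos).2 (by simpa using hS))

end RowSpecRad

/-- The joint (row) spectral radius of a tuple of matrices is the limit of
`‖Σ_{|w|=m} X^w (X^w)^*‖^{1/2m}`, it equals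
`inf { ‖Σ_j (S⁻¹X_jS)(S⁻¹X_jS)^*‖^{1/2} : S ∈ GLₙ(ℂ) }`, and it is `< 1` iff `X` is
jointly similar to a strict row contraction. -/
theorem rowSpecRad_eq_sInf_similarity (d n : ℕ) (X : Fin d → Matrix (Fin n) (Fin n) ℂ) :
    Tendsto
      (fun m : ℕ =>
        opNorm (∑ w : Fin m → Fin d, wordProd X w * (wordProd X w)ᴴ) ^ ((1 : ℝ) / (2 * m)))
      atTop (𝓝 (rowSpecRad X)) ∧
    rowSpecRad X
      = sInf {r : ℝ | ∃ S : (Matrix (Fin n) (Fin n) ℂ)ˣ,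
          r = Real.sqrt (opNorm (∑ j,
            (((S⁻¹ : (Matrix (Fin n) (Fin n) ℂ)ˣ) : Matrix (Fin n) (Fin n) ℂ) * X j * (S : Matrix (Fin n) (Fin n) ℂ))
              * (((S⁻¹ : (Matrix (Fin n) (Fin n) ℂ)ˣ) : Matrix (Fin n) (Fin n) ℂ) * X j * (S : Matrix (Fin n) (Fin n) ℂ))ᴴ))} ∧
    (rowSpecRad X < 1 ↔
      ∃ S : (Matrix (Fin n) (Fin n) ℂ)ˣ,
        opNorm (∑ j,
          (((S⁻¹ : (Matrix (Fin n) (Fin n) ℂ)ˣ) : Matrix (Fin n) (Fin n) ℂ) * X j * (S : Matrix (Fin n) (Fin n) ℂ))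
            * (((S⁻¹ : (Matrix (Fin n) (Fin n) ℂ)ˣ) : Matrix (Fin n) (Fin n) ℂ) * X j * (S : Matrix (Fin n) (Fin n) ℂ))ᴴ) < 1) := by
  exact ⟨tendsto_rpow_wordSum X, ((isGLB_rowSpecRad X).csInf_eq ⟨_, 1, rfl⟩).symm,
    rowSpecRad_lt_one_iff X⟩
end

section
/- Let f : 𝔻 → M_n(ℂ)^d be a holomorphic function on the open unit disc 𝔻 ⊂ ℂ (each matrix entry of each component is holomorphic) such that f(0) = 0 and for every z ∈ 𝔻 the tuple f(z) = (f₁(z),…,f_d(z)) is a strict row contraction, i.e. ‖Σ_{j=1}^d f_j(z) f_j(z)^*‖ < 1. Then for every z ∈ 𝔻, the joint (row) spectral radius satisfies ρ(f(z)) ≤ |z|; moreover ρ(f'(0)) ≤ 1, where f'(0) = (f₁'(0),…,f_d'(0)). -/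
open scoped Matrix

section RowSchwarz

open scoped Matrix.Norms.L2Operator

/-- The block row matrix `[X₁ ⋯ X_d]` of a tuple of matrices. -/
def blockRow {ι : Type*} {d : ℕ} (X : Fin d → Matrix ι ι ℂ) : Matrix ι (Fin d × ι) ℂ :=
  Matrix.of fun p jq => X jq.1 p jq.2

lemma blockRow_mul_conjTranspose {ι : Type*} [Fintype ι] {d : ℕ} (X : Fin d → Matrix ι ι ℂ) :
    blockRow X * (blockRow X)ᴴ = ∑ j, X j * (X j)ᴴ := by
  ext p q
  simp [Matrix.mul_apply, Matrix.sum_apply, blockRow, Fintype.sum_prod_type]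

lemma opNorm_sum_mul_conjTranspose {ι : Type*} [Fintype ι] [DecidableEq ι] {d : ℕ}
    (X : Fin d → Matrix ι ι ℂ) : opNorm (∑ j, X j * (X j)ᴴ) = ‖blockRow X‖ ^ 2 := by
  have h := Matrix.l2_opNorm_conjTranspose_mul_self (blockRow X)ᴴ
  rw [Matrix.conjTranspose_conjTranspose, blockRow_mul_conjTranspose,
    Matrix.l2_opNorm_conjTranspose, ← sq] at h
  exact h

lemma rowSpecRad_le_norm_blockRow {ι : Type*} [Fintype ι] [DecidableEq ι] {d : ℕ}
    (X : Fin d → Matrix ι ι ℂ) : rowSpecRad X ≤ ‖blockRow X‖ := by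
  have hbdd : BddBelow (Set.range fun m : {m : ℕ // 1 ≤ m} =>
      opNorm (∑ w : Fin (m : ℕ) → Fin d, wordProd X w * (wordProd X w)ᴴ)
        ^ ((1 : ℝ) / (2 * (m : ℕ)))) :=
    ⟨0, by rintro _ ⟨m, rfl⟩; exact Real.rpow_nonneg (norm_nonneg _) _⟩
  refine (ciInf_le hbdd ⟨1, le_rfl⟩).trans_eq ?_
  have hsum : ∑ w : Fin 1 → Fin d, wordProd X w * (wordProd X w)ᴴ = ∑ j, X j * (X j)ᴴ :=
    Fintype.sum_equiv (Equiv.funUnique (Fin 1) (Fin d)) _ _ fun w => by simp [wordProd]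
  rw [hsum, opNorm_sum_mul_conjTranspose, Nat.cast_one, mul_one, ← Real.sqrt_eq_rpow,
    Real.sqrt_sq (norm_nonneg _)]

lemma Matrix.hasDerivAt_of_apply {m n : Type*} [Fintype m] [Fintype n] [DecidableEq n]
    {F : ℂ → Matrix m n ℂ} {F' : Matrix m n ℂ} {z : ℂ}
    (h : ∀ p q, HasDerivAt (fun w => F w p q) (F' p q) z) : HasDerivAt F F' z := by
  classical
  have hsum (A : Matrix m n ℂ) :
      A = ∑ p, ∑ q, A p q • Matrix.single p q (1 : ℂ) := by
    simpa [Matrix.smul_single] using Matrix.matrix_eq_sum_single A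
  rw [hsum F', funext fun w => hsum (F w)]
  exact HasDerivAt.fun_sum fun p _ => HasDerivAt.fun_sum fun q _ => (h p q).smul_const _

lemma hasDerivAt_blockRow {ι : Type*} [Fintype ι] [DecidableEq ι] {d : ℕ}
    {f : ℂ → Fin d → Matrix ι ι ℂ} {z : ℂ}
    (h : ∀ j p q, DifferentiableAt ℂ (fun w => f w j p q) z) :
    HasDerivAt (fun w => blockRow (f w))
      (blockRow fun j => Matrix.of fun p q => deriv (fun w => f w j p q) z) z :=
  Matrix.hasDerivAt_of_apply fun p jq => (h jq.1 p jq.2).hasDerivAt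

end RowSchwarz

open scoped Matrix.Norms.L2Operator in
/-- Schwarz-type lemma for the joint (row) spectral radius: if `f : 𝔻 → Mₙ(ℂ)^d` is
holomorphic (entrywise), `f(0) = 0`, and `f(z)` is a strict row contraction for every
`z ∈ 𝔻`, then `ρ(f(z)) ≤ |z|` for every `z ∈ 𝔻`, and `ρ(f'(0)) ≤ 1`. -/
theorem rowSpecRad_schwarz (d n : ℕ) (f : ℂ → Fin d → Matrix (Fin n) (Fin n) ℂ)
    (hf : ∀ (j : Fin d) (p q : Fin n),
      DifferentiableOn ℂ (fun z => f z j p q) (Metric.ball (0 : ℂ) 1))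
    (hf0 : f 0 = 0)
    (hcon : ∀ z ∈ Metric.ball (0 : ℂ) 1, opNorm (∑ j, f z j * (f z j)ᴴ) < 1) :
    (∀ z ∈ Metric.ball (0 : ℂ) 1, rowSpecRad (f z) ≤ ‖z‖) ∧
    rowSpecRad (fun j => Matrix.of fun p q => deriv (fun z => f z j p q) 0) ≤ 1 := by
  have hderiv : ∀ z ∈ Metric.ball (0 : ℂ) 1, HasDerivAt (fun w => blockRow (f w))
      (blockRow fun j => Matrix.of fun p q => deriv (fun w => f w j p q) z) z := fun z hz =>
    hasDerivAt_blockRow fun j p q => (hf j p q).differentiableAt (Metric.isOpen_ball.mem_nhds hz)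
  have hdiff : DifferentiableOn ℂ (fun w => blockRow (f w)) (Metric.ball 0 1) := fun z hz =>
    (hderiv z hz).differentiableAt.differentiableWithinAt
  have hzero : blockRow (f 0) = 0 := by
    ext p jq
    simp [blockRow, hf0]
  have hmaps : Set.MapsTo (fun w => blockRow (f w)) (Metric.ball 0 1) (Metric.closedBall 0 1) := by
    intro z hz
    have h := hcon z hz
    rw [opNorm_sum_mul_conjTranspose, sq_lt_one_iff₀ (norm_nonneg _)] at h
    exact mem_closedBall_zero_iff.2 h.le
  refine ⟨fun z hz => (rowSpecRad_le_norm_blockRow _).trans ?_,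
    (rowSpecRad_le_norm_blockRow _).trans ?_⟩
  · exact Complex.norm_le_norm_of_mapsTo_ball hdiff hmaps hzero (mem_ball_zero_iff.1 hz)
  · rw [← (hderiv 0 (Metric.mem_ball_self one_pos)).deriv]
    exact Complex.norm_deriv_le_one_of_mapsTo_ball hdiff (by rwa [hzero]) one_pos
end
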